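/- Duality-gap lower bound for the suboptimality gap: let f : ℝⁿ → ℝ be convex, differentiable and ν_f-smooth, let Ω : ℝᵖ → ℝ ∪ {+∞} be proper, closed, convex and μ_Ω-strongly convex with μ_Ω ≥ 0, let X ∈ ℝ^{n×p}, and let β̂ be a minimizer of P(β) = f(Xβ) + Ω(β). Let β ∈ dom Ω, let α ≥ 1, set θ := −∇f(Xβ)/α, assume −θ ∈ dom f*, and let u ∈ ∂Ω*(X^⊤ θ) (assumed nonempty). Then for every s ∈ [0,1]: P(β) − P(β̂) ≥ s (Gap(β, θ) + Δ(α)) + (s(1−s) μ_Ω / 2) ‖β − u‖² − (s² ν_f / 2) ‖X(u − β)‖², where Δ(α) = f*(∇f(Xβ)) − f*(−θ) + (α − 1) ⟨θ, X u⟩. -/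

import Mathlib

noncomputable section

/-- Fenchel conjugate of an extended-real-valued function. -/
def fconj {m : ℕ} (h : EuclideanSpace ℝ (Fin m) → EReal) (v : EuclideanSpace ℝ (Fin m)) : EReal :=
  ⨆ x, ((inner ℝ v x : ℝ) : EReal) - h x

/-- Fenchel conjugate of a real-valued function. -/
def fconjR {m : ℕ} (h : EuclideanSpace ℝ (Fin m) → ℝ) (v : EuclideanSpace ℝ (Fin m)) : EReal :=
  ⨆ x, (((inner ℝ v x : ℝ) - h x : ℝ) : EReal)

/-- Subdifferential of an extended-real-valued function. -/
def subdiff {m : ℕ} (h : EuclideanSpace ℝ (Fin m) → EReal)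
    (x : EuclideanSpace ℝ (Fin m)) : Set (EuclideanSpace ℝ (Fin m)) :=
  {v | ∀ z, h x + ((inner ℝ v (z - x) : ℝ) : EReal) ≤ h z}

/-- Convexity for an extended-real-valued function. -/
def ERealConvexOn {m : ℕ} (h : EuclideanSpace ℝ (Fin m) → EReal) : Prop :=
  ∀ x y : EuclideanSpace ℝ (Fin m), ∀ a b : ℝ, 0 ≤ a → 0 ≤ b → a + b = 1 →
    h (a • x + b • y) ≤ (a : EReal) * h x + (b : EReal) * h y

/-- `X v` for a matrix `X ∈ ℝ^{n×p}` and `v ∈ ℝᵖ`. -/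
def mv {n p : ℕ} (X : Matrix (Fin n) (Fin p) ℝ) (v : EuclideanSpace ℝ (Fin p)) :
    EuclideanSpace ℝ (Fin n) :=
  WithLp.toLp 2 fun i => ∑ j, X i j * v j

/-- `X^⊤ θ` for a matrix `X ∈ ℝ^{n×p}` and `θ ∈ ℝⁿ`. -/
def mvT {n p : ℕ} (X : Matrix (Fin n) (Fin p) ℝ) (θ : EuclideanSpace ℝ (Fin n)) :
    EuclideanSpace ℝ (Fin p) :=
  WithLp.toLp 2 fun j => ∑ i, X i j * θ i

theorem aux_mv_inner {n p : ℕ} (X : Matrix (Fin n) (Fin p) ℝ) (θ : EuclideanSpace ℝ (Fin n))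
    (u : EuclideanSpace ℝ (Fin p)) : inner ℝ u (mvT X θ) = inner ℝ θ (mv X u) := by
  simp only [mv, mvT, PiLp.inner_apply, RCLike.inner_apply, conj_trivial, Finset.sum_mul,
    Finset.mul_sum]
  rw [Finset.sum_comm]
  refine Finset.sum_congr rfl fun i _ => Finset.sum_congr rfl fun j _ => ?_
  ring

theorem aux_mv_lin {n p : ℕ} (X : Matrix (Fin n) (Fin p) ℝ) (a b : ℝ)
    (u v : EuclideanSpace ℝ (Fin p)) : mv X (a • u + b • v) = a • mv X u + b • mv X v := by
  ext i
  simp only [mv, PiLp.add_apply, PiLp.smul_apply, smul_eq_mul, Finset.mul_sum,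
    ← Finset.sum_add_distrib]
  refine Finset.sum_congr rfl fun j _ => ?_
  ring

theorem aux_descent {n : ℕ} (f : EuclideanSpace ℝ (Fin n) → ℝ)
    (gradf : EuclideanSpace ℝ (Fin n) → EuclideanSpace ℝ (Fin n))
    (hgrad : ∀ x, HasGradientAt f (gradf x) x) (νf : ℝ)
    (hsmooth : ∀ x y, ‖gradf x - gradf y‖ ≤ νf * ‖x - y‖) (x d : EuclideanSpace ℝ (Fin n)) :
    f (x + d) ≤ f x + inner ℝ (gradf x) d + νf / 2 * ‖d‖ ^ 2 := by
  have hd : ∀ t : ℝ, HasDerivAt (fun t : ℝ => f (x + t • d) - t * inner ℝ (gradf x) d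
      - t ^ 2 * (νf / 2 * ‖d‖ ^ 2))
      (inner ℝ (gradf (x + t • d)) d - inner ℝ (gradf x) d - 2 * t * (νf / 2 * ‖d‖ ^ 2)) t := by
    intro t
    have h1 : HasDerivAt (fun t : ℝ => x + t • d) d t := by
      simpa using ((hasDerivAt_id t).smul_const d).const_add x
    have h2 := (hgrad (x + t • d)).hasFDerivAt.comp_hasDerivAt t h1
    have h3 : HasDerivAt (fun t : ℝ => t * inner ℝ (gradf x) d) (inner ℝ (gradf x) d) t := by
      simpa using (hasDerivAt_id t).mul_const (inner ℝ (gradf x) d)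
    have h4 : HasDerivAt (fun t : ℝ => t ^ 2 * (νf / 2 * ‖d‖ ^ 2)) (2 * t * (νf / 2 * ‖d‖ ^ 2)) t := by
      simpa using (hasDerivAt_pow 2 t).mul_const (νf / 2 * ‖d‖ ^ 2)
    have h5 := (h2.sub h3).sub h4
    have h6 : ((InnerProductSpace.toDual ℝ (EuclideanSpace ℝ (Fin n))) (gradf (x + t • d))) d
        = inner ℝ (gradf (x + t • d)) d := by simp
    rw [h6] at h5
    exact h5
  have hanti := antitoneOn_of_deriv_nonpos (convex_Icc (0:ℝ) 1)
    (fun t _ => (hd t).continuousAt.continuousWithinAt)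
    (fun t _ => (hd t).differentiableAt.differentiableWithinAt) (by
      intro t ht
      rw [interior_Icc] at ht
      rw [(hd t).deriv]
      have h1 := hsmooth (x + t • d) x
      have h2 := real_inner_le_norm (gradf (x + t • d) - gradf x) d
      rw [inner_sub_left] at h2
      have h3 : ‖x + t • d - x‖ = t * ‖d‖ := by
        rw [add_sub_cancel_left, norm_smul, Real.norm_of_nonneg ht.1.le]
      rw [h3] at h1
      have h4 := mul_le_mul_of_nonneg_right h1 (norm_nonneg d)
      nlinarith)
  have := hanti (Set.left_mem_Icc.2 zero_le_one) (Set.right_mem_Icc.2 zero_le_one) zero_le_one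
  simp at this
  linarith

theorem aux_fconjR {n : ℕ} (f : EuclideanSpace ℝ (Fin n) → ℝ) (hf : ConvexOn ℝ Set.univ f)
    (g x : EuclideanSpace ℝ (Fin n)) (hg : HasGradientAt f g x) :
    fconjR f g = ((inner ℝ g x - f x : ℝ) : EReal) := by
  refine le_antisymm (iSup_le fun y => ?_) (le_iSup (fun y => ((inner ℝ g y - f y : ℝ) : EReal)) x)
  rw [EReal.coe_le_coe_iff]
  have h1 : HasDerivAt (fun t : ℝ => x + t • (y - x)) (y - x) 0 := by
    simpa using ((hasDerivAt_id (0:ℝ)).smul_const (y - x)).const_add x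
  have h2 : HasDerivAt (fun t : ℝ => f (x + t • (y - x))) (inner ℝ g (y - x)) 0 := by
    have hg' : HasGradientAt f g (x + (0:ℝ) • (y - x)) := by simpa using hg
    have h5 := hg'.hasFDerivAt.comp_hasDerivAt (0:ℝ) h1
    have h6 : ((InnerProductSpace.toDual ℝ (EuclideanSpace ℝ (Fin n))) g) (y - x)
        = inner ℝ g (y - x) := by simp
    rw [h6] at h5
    exact h5
  have hc : ConvexOn ℝ Set.univ (fun t : ℝ => f (x + t • (y - x))) := by
    refine ⟨convex_univ, fun s _ t _ a b ha hb hab => ?_⟩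
    have := hf.2 (Set.mem_univ (x + s • (y - x))) (Set.mem_univ (x + t • (y - x))) ha hb hab
    have e : x + (a • s + b • t) • (y - x) = a • (x + s • (y - x)) + b • (x + t • (y - x)) := by
      have : x = (a + b) • x := by rw [hab, one_smul]
      rw [smul_eq_mul, smul_eq_mul]
      nth_rewrite 1 [this]
      module
    simp only [e]
    exact this
  have := hc.le_slope_of_hasDerivAt (Set.mem_univ 0) (Set.mem_univ 1) zero_lt_one h2
  simp [slope_def_field, inner_sub_right] at this
  linarith

theorem aux_strong {p : ℕ} (Ω : EuclideanSpace ℝ (Fin p) → EReal) (μΩ : ℝ)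
    (hΩ_strong : ERealConvexOn (fun b => Ω b - ((μΩ / 2 * ‖b‖ ^ 2 : ℝ) : EReal)))
    (x y : EuclideanSpace ℝ (Fin p)) (r q a b : ℝ) (hx : Ω x ≤ r) (hy : Ω y ≤ q)
    (ha : 0 ≤ a) (hb : 0 ≤ b) (hab : a + b = 1) :
    Ω (a • x + b • y) ≤ ((a * r + b * q - a * b * μΩ / 2 * ‖x - y‖ ^ 2 : ℝ) : EReal) := by
  have h := hΩ_strong x y a b ha hb hab
  simp only at h
  have h1 : (a : EReal) * (Ω x - ((μΩ / 2 * ‖x‖ ^ 2 : ℝ) : EReal)) ≤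
      ((a * (r - μΩ / 2 * ‖x‖ ^ 2) : ℝ) : EReal) := by
    rw [EReal.coe_mul a, EReal.coe_sub]
    exact mul_le_mul_of_nonneg_left (EReal.sub_le_sub hx le_rfl) (by exact_mod_cast ha)
  have h2 : (b : EReal) * (Ω y - ((μΩ / 2 * ‖y‖ ^ 2 : ℝ) : EReal)) ≤
      ((b * (q - μΩ / 2 * ‖y‖ ^ 2) : ℝ) : EReal) := by
    rw [EReal.coe_mul b, EReal.coe_sub]
    exact mul_le_mul_of_nonneg_left (EReal.sub_le_sub hy le_rfl) (by exact_mod_cast hb)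
  have h3 := h.trans (add_le_add h1 h2)
  rw [← EReal.coe_add, EReal.sub_le_iff_le_add (Or.inl (EReal.coe_ne_bot _)) (Or.inl (EReal.coe_ne_top _)), ← EReal.coe_add] at h3
  refine h3.trans (EReal.coe_le_coe_iff.2 (le_of_eq ?_))
  have e1 : ‖a • x + b • y‖ ^ 2 = a ^ 2 * ‖x‖ ^ 2 + 2 * (a * b * inner ℝ x y) + b ^ 2 * ‖y‖ ^ 2 := by
    rw [norm_add_sq_real, inner_smul_left, inner_smul_right, norm_smul, norm_smul,
      mul_pow, mul_pow]
    simp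
    ring
  rw [e1, norm_sub_sq_real]
  have : b = 1 - a := by linarith
  subst this
  ring

/-- Separation of a point below the graph from the epigraph. -/
theorem aux_sep {p : ℕ} (Ω : EuclideanSpace ℝ (Fin p) → EReal)
    (hp : ∃ x, Ω x ≠ ⊤) (hnb : ∀ x, Ω x ≠ ⊥) (hl : LowerSemicontinuous Ω)
    (μΩ : ℝ) (hμ : 0 ≤ μΩ)
    (hs : ERealConvexOn (fun b => Ω b - ((μΩ / 2 * ‖b‖ ^ 2 : ℝ) : EReal)))
    (u : EuclideanSpace ℝ (Fin p)) (r : ℝ) (hr : ¬ Ω u ≤ r) :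
    ∃ (v : EuclideanSpace ℝ (Fin p)) (t k : ℝ), t ≤ 0 ∧ k < inner ℝ v u + t * r ∧
      ∀ x (q : ℝ), Ω x ≤ q → inner ℝ v x + t * q < k := by
  let S : Set (EuclideanSpace ℝ (Fin p) × ℝ) := {z | Ω z.1 ≤ (z.2 : EReal)}
  have hS : Convex ℝ S := by
    rintro ⟨x, a⟩ hx ⟨y, b⟩ hy s t hs0 ht hst
    have h := aux_strong Ω μΩ hs x y a b s t hx hy hs0 ht hst
    refine h.trans (EReal.coe_le_coe_iff.2 ?_)
    have : 0 ≤ s * t * μΩ / 2 * ‖x - y‖ ^ 2 := by positivity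
    simp
    linarith
  have hC : IsClosed S := by
    have h1 := hl.isClosed_epigraph
    have h2 : Continuous (fun z : EuclideanSpace ℝ (Fin p) × ℝ => (z.1, (z.2 : EReal))) := by
      exact continuous_fst.prodMk (continuous_coe_real_ereal.comp continuous_snd)
    exact h1.preimage h2
  obtain ⟨F, k, h1, h2⟩ := geometric_hahn_banach_closed_point hS hC (x := (u, r)) hr
  let G : EuclideanSpace ℝ (Fin p) →L[ℝ] ℝ := F.comp (ContinuousLinearMap.inl ℝ _ _)
  have hF : ∀ x q, F (x, q) = inner ℝ ((InnerProductSpace.toDual ℝ _).symm G) x + F (0, 1) * q := by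
    intro x q
    rw [InnerProductSpace.toDual_symm_apply]
    have : (x, q) = (x, (0:ℝ)) + q • ((0 : EuclideanSpace ℝ (Fin p)), (1:ℝ)) := by simp
    rw [this, map_add, map_smul]
    simp [G, mul_comm]
  refine ⟨(InnerProductSpace.toDual ℝ _).symm G, F (0, 1), k, ?_, ?_, ?_⟩
  · by_contra! ht
    obtain ⟨x, hx⟩ := hp
    obtain ⟨a, ha⟩ : ∃ a : ℝ, Ω x = a := ⟨(Ω x).toReal, (EReal.coe_toReal hx (hnb x)).symm⟩
    have hb : ∀ q, a ≤ q → F (x, q) < k := fun q hq =>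
      h1 (x, q) (by change Ω x ≤ (q : EReal); rw [ha]; exact_mod_cast hq)
    have h3 := hb (a + |k - F (x, a)| / F (0, 1)) (by
      have : 0 ≤ |k - F (x, a)| / F (0, 1) := by positivity
      linarith)
    have h4 := le_abs_self (k - F (x, a))
    rw [hF x (a + _), mul_add, mul_div_cancel₀ _ ht.ne'] at h3
    rw [hF x a] at h3 h4
    linarith
  · rw [← hF]; exact h2
  · intro x q hq
    rw [← hF]; exact h1 (x, q) hq

theorem aux_fconj_le {p : ℕ} (Ω : EuclideanSpace ℝ (Fin p) → EReal) (hnb : ∀ x, Ω x ≠ ⊥)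
    (v : EuclideanSpace ℝ (Fin p)) (k : ℝ)
    (h : ∀ x (q : ℝ), Ω x = q → inner ℝ v x - q ≤ k) : fconj Ω v ≤ k := by
  refine iSup_le fun x => ?_
  by_cases hx : Ω x = ⊤
  · simp [hx]
  · have e := EReal.coe_toReal hx (hnb x)
    rw [← e, ← EReal.coe_sub, EReal.coe_le_coe_iff]
    exact h x _ e.symm

theorem aux_le_fconj {p : ℕ} (Ω : EuclideanSpace ℝ (Fin p) → EReal)
    (v x : EuclideanSpace ℝ (Fin p)) (q : ℝ) (hq : Ω x = q) :
    ((inner ℝ v x - q : ℝ) : EReal) ≤ fconj Ω v := by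
  rw [EReal.coe_sub, ← hq]
  exact le_iSup (fun x => ((inner ℝ v x : ℝ) : EReal) - Ω x) x

theorem aux_FM {p : ℕ} (Ω : EuclideanSpace ℝ (Fin p) → EReal)
    (hp : ∃ x, Ω x ≠ ⊤) (hnb : ∀ x, Ω x ≠ ⊥) (hl : LowerSemicontinuous Ω)
    (μΩ : ℝ) (hμ : 0 ≤ μΩ)
    (hs : ERealConvexOn (fun b => Ω b - ((μΩ / 2 * ‖b‖ ^ 2 : ℝ) : EReal)))
    (u w : EuclideanSpace ℝ (Fin p)) (hu : u ∈ subdiff (fconj Ω) w) :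
    ∃ c : ℝ, fconj Ω w = c ∧ Ω u ≤ ((inner ℝ u w - c : ℝ) : EReal) := by
  -- normalisation of a strict separation
  have key : ∀ (v : EuclideanSpace ℝ (Fin p)) (t k : ℝ), t < 0 →
      (∀ x (q : ℝ), Ω x ≤ q → inner ℝ v x + t * q < k) →
      fconj Ω ((-t)⁻¹ • v) ≤ (((-t)⁻¹ * k : ℝ) : EReal) := by
    intro v t k ht h
    refine aux_fconj_le Ω hnb _ _ fun x q hq => ?_
    have h1 := mul_le_mul_of_nonneg_left (h x q hq.le).le
      (inv_nonneg.2 (neg_nonneg.2 ht.le))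
    rw [inner_smul_left]
    have : (-t)⁻¹ * (t * q) = -q := by
      have := ht.ne
      field_simp
    simp only [conj_trivial]
    rw [mul_add, this] at h1
    linarith
  obtain ⟨c, hc⟩ : ∃ c : ℝ, fconj Ω w = c := by
    obtain ⟨x, hx⟩ := hp
    obtain ⟨a, ha⟩ : ∃ a : ℝ, Ω x = a := ⟨(Ω x).toReal, (EReal.coe_toReal hx (hnb x)).symm⟩
    obtain ⟨v, t, k, ht, h1, h2⟩ := aux_sep Ω ⟨x, hx⟩ hnb hl μΩ hμ hs x (a - 1) (by
      rw [ha, EReal.coe_le_coe_iff]; linarith)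
    have h3 := h2 x a ha.le
    have ht' : t < 0 := by nlinarith
    have h4 := (hu ((-t)⁻¹ • v)).trans (key v t k ht' h2)
    refine ⟨(fconj Ω w).toReal, (EReal.coe_toReal ?_ ?_).symm⟩
    · intro h
      rw [h, EReal.top_add_coe] at h4
      exact EReal.coe_ne_top _ (top_le_iff.1 h4)
    · intro h
      have := aux_le_fconj Ω w x a ha
      rw [h] at this
      exact EReal.coe_ne_bot _ (le_bot_iff.1 this)
  refine ⟨c, hc, ?_⟩
  by_contra hr
  obtain ⟨v, t, k, ht, h1, h2⟩ := aux_sep Ω hp hnb hl μΩ hμ hs u _ hr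
  rcases ht.lt_or_eq with ht | rfl
  · have h4 := (hu ((-t)⁻¹ • v)).trans (key v t k ht h2)
    rw [hc, ← EReal.coe_add, EReal.coe_le_coe_iff, inner_sub_right, inner_smul_right,
      real_inner_comm] at h4
    have h5 := mul_lt_mul_of_pos_left h1 (inv_pos.2 (neg_pos.2 ht))
    have : (-t)⁻¹ * (t * (inner ℝ u w - c)) = -(inner ℝ u w - c) := by
      have := ht.ne
      field_simp
    rw [mul_add, this] at h5
    linarith
  · have h3 : fconj Ω (w + v) ≤ ((c + k : ℝ) : EReal) := by
      refine aux_fconj_le Ω hnb _ _ fun x q hq => ?_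
      have h4 := aux_le_fconj Ω w x q hq
      rw [hc, EReal.coe_le_coe_iff] at h4
      have h5 := h2 x q hq.le
      rw [inner_add_left]
      linarith
    have h4 := (hu (w + v)).trans h3
    rw [hc, ← EReal.coe_add, EReal.coe_le_coe_iff, add_sub_cancel_left, real_inner_comm] at h4
    linarith

/-- **Duality-gap lower bound for the suboptimality gap.** For `f` convex,
differentiable, `ν_f`-smooth, `Ω` proper closed convex `μ_Ω`-strongly convex
(`μ_Ω ≥ 0`), `β̂` a minimizer of `P(β) = f(Xβ) + Ω(β)`, `β ∈ dom Ω`, `α ≥ 1`,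
`θ = −∇f(Xβ)/α` with `−θ ∈ dom f*`, and `u ∈ ∂Ω*(X^⊤θ)`: for every `s ∈ [0,1]`,
`P(β) − P(β̂) ≥ s(Gap(β,θ) + Δ(α)) + (s(1−s)μ_Ω/2)‖β − u‖² − (s²ν_f/2)‖X(u−β)‖²`,
where `Δ(α) = f*(∇f(Xβ)) − f*(−θ) + (α−1)⟨θ, Xu⟩`. -/
theorem duality_gap_lower_bound_suboptimality (n p : ℕ)
    (f : EuclideanSpace ℝ (Fin n) → ℝ) (hf_convex : ConvexOn ℝ Set.univ f)
    (gradf : EuclideanSpace ℝ (Fin n) → EuclideanSpace ℝ (Fin n))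
    (hgrad : ∀ x, HasGradientAt f (gradf x) x)
    (νf : ℝ) (hν : 0 ≤ νf)
    (hsmooth : ∀ x y, ‖gradf x - gradf y‖ ≤ νf * ‖x - y‖)
    (Ω : EuclideanSpace ℝ (Fin p) → EReal)
    (hΩ_ne_bot : ∀ x, Ω x ≠ ⊥) (hΩ_proper : ∃ x, Ω x ≠ ⊤)
    (hΩ_closed : LowerSemicontinuous Ω)
    (μΩ : ℝ) (hμ : 0 ≤ μΩ)
    (hΩ_strong : ERealConvexOn (fun b => Ω b - ((μΩ / 2 * ‖b‖ ^ 2 : ℝ) : EReal)))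
    (X : Matrix (Fin n) (Fin p) ℝ)
    (βhat : EuclideanSpace ℝ (Fin p))
    (hmin : ∀ b, ((f (mv X βhat) : ℝ) : EReal) + Ω βhat ≤ ((f (mv X b) : ℝ) : EReal) + Ω b)
    (β : EuclideanSpace ℝ (Fin p)) (hβ_dom : Ω β ≠ ⊤)
    (α : ℝ) (hα : 1 ≤ α)
    (θ : EuclideanSpace ℝ (Fin n)) (hθ : θ = (-(1 / α)) • gradf (mv X β))
    (hθ_dom : fconjR f (-θ) ≠ ⊤)
    (u : EuclideanSpace ℝ (Fin p)) (hu : u ∈ subdiff (fconj Ω) (mvT X θ)) :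
    ∀ s : ℝ, 0 ≤ s → s ≤ 1 →
      ((s : ℝ) : EReal) *
          ((((f (mv X β) : ℝ) : EReal) + Ω β
              - (-(fconjR f (-θ)) - fconj Ω (mvT X θ)))
            + (fconjR f (gradf (mv X β)) - fconjR f (-θ)
                + (((α - 1) * (inner ℝ θ (mv X u) : ℝ) : ℝ) : EReal)))
        + ((s * (1 - s) * μΩ / 2 * ‖β - u‖ ^ 2 : ℝ) : EReal)
        - ((s ^ 2 * νf / 2 * ‖mv X (u - β)‖ ^ 2 : ℝ) : EReal)
      ≤ (((f (mv X β) : ℝ) : EReal) + Ω β) - (((f (mv X βhat) : ℝ) : EReal) + Ω βhat) := by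
  intro s hs0 hs1
  obtain ⟨c, hc, hΩu⟩ := aux_FM Ω hΩ_proper hΩ_ne_bot hΩ_closed μΩ hμ hΩ_strong u _ hu
  obtain ⟨b, hb⟩ : ∃ b : ℝ, Ω β = b :=
    ⟨(Ω β).toReal, (EReal.coe_toReal hβ_dom (hΩ_ne_bot β)).symm⟩
  have hm := hmin β
  obtain ⟨bh, hbh⟩ : ∃ bh : ℝ, Ω βhat = bh := by
    refine ⟨(Ω βhat).toReal, (EReal.coe_toReal ?_ (hΩ_ne_bot βhat)).symm⟩
    intro h
    rw [h, hb, EReal.coe_add_top, ← EReal.coe_add] at hm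
    exact EReal.coe_ne_top _ (top_le_iff.1 hm)
  obtain ⟨d, hd⟩ : ∃ d : ℝ, fconjR f (-θ) = d := by
    refine ⟨(fconjR f (-θ)).toReal, (EReal.coe_toReal hθ_dom ?_).symm⟩
    intro h
    have := le_iSup (fun x => (((inner ℝ (-θ) x : ℝ) - f x : ℝ) : EReal)) 0
    change _ ≤ fconjR f (-θ) at this
    rw [h] at this
    exact EReal.coe_ne_bot _ (le_bot_iff.1 this)
  have hg := aux_fconjR f hf_convex _ _ (hgrad (mv X β))
  have hst := aux_strong Ω μΩ hΩ_strong β u b _ (1 - s) s hb.le hΩu (by linarith) hs0 (by ring)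
  have hm2 := (hmin ((1 - s) • β + s • u)).trans (add_le_add le_rfl hst)
  rw [hbh, ← EReal.coe_add, ← EReal.coe_add, EReal.coe_le_coe_iff] at hm2
  have hX : mv X (u - β) = mv X u - mv X β := by
    have := aux_mv_lin X 1 (-1) u β
    simpa [sub_eq_add_neg] using this
  have hX2 : mv X ((1 - s) • β + s • u) = mv X β + s • mv X (u - β) := by
    rw [aux_mv_lin, hX]; module
  have hde := aux_descent f gradf hgrad νf hsmooth (mv X β) (s • mv X (u - β))
  rw [← hX2, inner_smul_right, norm_smul, mul_pow, Real.norm_eq_abs, sq_abs] at hde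
  have hgi : inner ℝ (gradf (mv X β)) (mv X (u - β))
      = inner ℝ (gradf (mv X β)) (mv X u) - inner ℝ (gradf (mv X β)) (mv X β) := by
    rw [hX, inner_sub_right]
  have hin := aux_mv_inner X θ u
  have hgθ : inner ℝ (gradf (mv X β)) (mv X u) = - (α * inner ℝ θ (mv X u)) := by
    have : α ≠ 0 := by linarith
    rw [hθ, inner_smul_left]
    simp only [conj_trivial]
    field_simp
  rw [hb, hbh, hc, hd, hg]
  simp only [← EReal.coe_add, ← EReal.coe_sub, ← EReal.coe_neg, ← EReal.coe_mul,
    EReal.coe_le_coe_iff]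
  rw [hin] at hm2
  rw [hgi, hgθ] at hde
  linarith
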